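/- Let k be an algebraically closed field of characteristic different from 2, let g, h ∈ k with h ≠ 0, and let T = T(g,h). Define left T-module homomorphisms (with T acting by left multiplication): d₁ : T³ → T by (u₁,u₂,u₃) ↦ u₁·x + u₂·y + u₃·w; d₂ : T³ → T³ by (u₁,u₂,u₃) ↦ (-u₁·x - u₃·y, u₁·(w - g·y) + u₂·h·y + u₃·x, u₁·y + u₂·w); d₃ : T → T³ by t ↦ (t·h·y, t·w, -t·h·x); and let ε : T → k be the unique k-algebra homomorphism with ε(x) = ε(y) = ε(w) = 0. Then the sequence 0 → T →(d₃) T³ →(d₂) T³ →(d₁) T →(ε) k → 0 is exact: d₃ is injective, the kernel of d₂ equals the image of d₃, the kernel of d₁ equals the image of d₂, the kernel of ε equals the image of d₁, and ε is surjective. (That is, this complex is a free resolution of the trivial left T-module k; in particular T is Koszul when h ≠ 0.) -/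

import Mathlib

noncomputable section

open FreeAlgebra

/-- The generator `x` of the free algebra `k⟨x,y,w⟩`. -/
def Xf (k : Type*) [Field k] : FreeAlgebra k (Fin 3) := FreeAlgebra.ι k 0

/-- The generator `y` of the free algebra `k⟨x,y,w⟩`. -/
def Yf (k : Type*) [Field k] : FreeAlgebra k (Fin 3) := FreeAlgebra.ι k 1

/-- The generator `w` of the free algebra `k⟨x,y,w⟩`. -/
def Wf (k : Type*) [Field k] : FreeAlgebra k (Fin 3) := FreeAlgebra.ι k 2

/-- The relations defining `T(g,h) = k⟨x,y,w⟩/⟨xy - yx, wy + yw - x² - g·y², w² + h·y²⟩`. -/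
def Wrel (k : Type*) [Field k] (g h : k) :
    FreeAlgebra k (Fin 3) → FreeAlgebra k (Fin 3) → Prop := fun m n =>
  (m = Xf k * Yf k ∧ n = Yf k * Xf k) ∨
  (m = Wf k * Yf k + Yf k * Wf k ∧ n = (Xf k) ^ 2 + g • (Yf k) ^ 2) ∨
  (m = (Wf k) ^ 2 ∧ n = -(h • (Yf k) ^ 2))

/-- The algebra `T(g,h)`. -/
abbrev Tgh (k : Type*) [Field k] (g h : k) := RingQuot (Wrel k g h)

/-- The image of `x` in `T(g,h)`. -/
def Wx (k : Type*) [Field k] (g h : k) : Tgh k g h :=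
  RingQuot.mkAlgHom k (Wrel k g h) (Xf k)

/-- The image of `y` in `T(g,h)`. -/
def Wy (k : Type*) [Field k] (g h : k) : Tgh k g h :=
  RingQuot.mkAlgHom k (Wrel k g h) (Yf k)

/-- The image of `w` in `T(g,h)`. -/
def Ww (k : Type*) [Field k] (g h : k) : Tgh k g h :=
  RingQuot.mkAlgHom k (Wrel k g h) (Wf k)

/-- The map `d₁ : T³ → T`, `(u₁,u₂,u₃) ↦ u₁·x + u₂·y + u₃·w` (a homomorphism of left
`T`-modules, `T` acting by left multiplication). -/
def d1 (k : Type*) [Field k] (g h : k) (u : Tgh k g h × Tgh k g h × Tgh k g h) : Tgh k g h :=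
  u.1 * Wx k g h + u.2.1 * Wy k g h + u.2.2 * Ww k g h

/-- The map `d₂ : T³ → T³`,
`(u₁,u₂,u₃) ↦ (-u₁·x - u₃·y, u₁·(w - g·y) + u₂·h·y + u₃·x, u₁·y + u₂·w)`. -/
def d2 (k : Type*) [Field k] (g h : k) (u : Tgh k g h × Tgh k g h × Tgh k g h) :
    Tgh k g h × Tgh k g h × Tgh k g h :=
  (-(u.1 * Wx k g h) - u.2.2 * Wy k g h,
   u.1 * (Ww k g h - g • Wy k g h) + u.2.1 * (h • Wy k g h) + u.2.2 * Wx k g h,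
   u.1 * Wy k g h + u.2.1 * Ww k g h)

/-- The map `d₃ : T → T³`, `t ↦ (t·h·y, t·w, -t·h·x)`. -/
def d3 (k : Type*) [Field k] (g h : k) (t : Tgh k g h) :
    Tgh k g h × Tgh k g h × Tgh k g h :=
  (t * (h • Wy k g h), t * Ww k g h, -(t * (h • Wx k g h)))


namespace Tgh

variable {k : Type*} [Field k] {g h : k}

theorem x_mul_y : Wx k g h * Wy k g h = Wy k g h * Wx k g h := by
  simpa [Wx, Wy] using RingQuot.mkAlgHom_rel k (s := Wrel k g h) (Or.inl ⟨rfl, rfl⟩)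

theorem w_mul_y_add : Ww k g h * Wy k g h + Wy k g h * Ww k g h =
    Wx k g h ^ 2 + g • Wy k g h ^ 2 := by
  simpa [Wx, Wy, Ww] using
    RingQuot.mkAlgHom_rel k (s := Wrel k g h) (Or.inr (Or.inl ⟨rfl, rfl⟩))

theorem w_sq : Ww k g h ^ 2 = -(h • Wy k g h ^ 2) := by
  simpa [Wy, Ww] using
    RingQuot.mkAlgHom_rel k (s := Wrel k g h) (Or.inr (Or.inr ⟨rfl, rfl⟩))

theorem induction {motive : Tgh k g h → Prop}
    (scalar : ∀ r : k, motive (algebraMap k _ r))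
    (x : motive (Wx k g h)) (y : motive (Wy k g h)) (w : motive (Ww k g h))
    (mul : ∀ a b, motive a → motive b → motive (a * b))
    (add : ∀ a b, motive a → motive b → motive (a + b)) (t : Tgh k g h) : motive t := by
  obtain ⟨t, rfl⟩ := RingQuot.mkAlgHom_surjective k (Wrel k g h) t
  induction t using FreeAlgebra.induction with
  | grade0 r => simpa using scalar r
  | grade1 i => fin_cases i <;> assumption
  | mul a b ha hb => simpa using mul _ _ ha hb
  | add a b ha hb => simpa using add _ _ ha hb

section Lift

variable {B : Type*} [Ring B] [Algebra k B] (x y w : B)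

theorem exists_lift (hxy : x * y = y * x) (hwy : w * y + y * w = x ^ 2 + g • y ^ 2)
    (hww : w ^ 2 = -(h • y ^ 2)) :
    ∃ f : Tgh k g h →ₐ[k] B, f (Wx k g h) = x ∧ f (Wy k g h) = y ∧ f (Ww k g h) = w := by
  refine ⟨RingQuot.liftAlgHom k ⟨FreeAlgebra.lift k ![x, y, w], ?_⟩, ?_, ?_, ?_⟩
  · rintro _ _ (⟨rfl, rfl⟩ | ⟨rfl, rfl⟩ | ⟨rfl, rfl⟩)
    · simpa [Xf, Yf] using hxy
    · simpa [Xf, Yf, Wf] using hwy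
    · simpa [Yf, Wf] using hww
  · simp [Wx, Xf]
  · simp [Wy, Yf]
  · simp [Ww, Wf]

end Lift

/-! ### Exactness at `T` and at the first `T³` -/

theorem d1_d2 (u : Tgh k g h × Tgh k g h × Tgh k g h) : d1 k g h (d2 k g h u) = 0 := by
  obtain ⟨a, b, c⟩ := u
  have h1 := congrArg (c * ·) (x_mul_y (k := k) (g := g) (h := h))
  have h2 := congrArg (a * ·) (w_mul_y_add (k := k) (g := g) (h := h))
  have h3 := congrArg (b * ·) (w_sq (k := k) (g := g) (h := h))
  simp only [d1, d2, pow_two, mul_add, add_mul, sub_mul, mul_sub, neg_mul (α := Tgh k g h), mul_neg (α := Tgh k g h),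
    smul_mul_assoc, mul_smul_comm, mul_assoc] at *
  linear_combination (norm := module) h1 + h2 + h3

theorem d2_d3 (t : Tgh k g h) : d2 k g h (d3 k g h t) = 0 := by
  have h1 := congrArg (t * ·) (x_mul_y (k := k) (g := g) (h := h))
  have h2 := congrArg (h • t * ·) (w_mul_y_add (k := k) (g := g) (h := h))
  have h3 := congrArg (t * ·) (w_sq (k := k) (g := g) (h := h))
  simp only [d2, d3, pow_two, mul_add, mul_sub, neg_mul (α := Tgh k g h), mul_neg (α := Tgh k g h),
    smul_mul_assoc, mul_smul_comm, mul_assoc, Prod.mk_eq_zero] at *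
  refine ⟨?_, ?_, ?_⟩
  · linear_combination (norm := module) h • h1
  · linear_combination (norm := module) h2
  · linear_combination (norm := module) h3

theorem exists_d1_add_algebraMap (ε : Tgh k g h →ₐ[k] k) (hεx : ε (Wx k g h) = 0)
    (hεy : ε (Wy k g h) = 0) (hεw : ε (Ww k g h) = 0) (t : Tgh k g h) :
    ∃ u, d1 k g h u + algebraMap k _ (ε t) = t := by
  induction t using Tgh.induction with
  | scalar r => exact ⟨0, by simp [d1]⟩
  | x => exact ⟨(1, 0, 0), by simp [d1, hεx]⟩
  | y => exact ⟨(0, 1, 0), by simp [d1, hεy]⟩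
  | w => exact ⟨(0, 0, 1), by simp [d1, hεw]⟩
  | mul a b ha hb =>
    obtain ⟨u, hu⟩ := ha
    obtain ⟨v, hv⟩ := hb
    refine ⟨a • v + ε b • u, ?_⟩
    rw [map_mul, map_mul, Algebra.commutes]
    have : d1 k g h (a • v + ε b • u) = a * d1 k g h v + algebraMap k _ (ε b) * d1 k g h u := by
      simp only [d1, Prod.fst_add, Prod.snd_add, Prod.smul_fst, Prod.smul_snd, smul_eq_mul,
        ← Algebra.smul_def, add_mul, mul_add, smul_mul_assoc, mul_assoc]
      abel
    rw [this, add_assoc, ← mul_add, hu, Algebra.commutes, ← mul_add, hv]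
  | add a b ha hb =>
    obtain ⟨u, hu⟩ := ha
    obtain ⟨v, hv⟩ := hb
    refine ⟨u + v, ?_⟩
    have : d1 k g h (u + v) = d1 k g h u + d1 k g h v := by
      simp only [d1, Prod.fst_add, Prod.snd_add]
      noncomm_ring
    rw [this, map_add, map_add, add_add_add_comm, hu, hv]

variable (k g h) in
/-- The image of `d2`, as a left `T`-submodule of `T³`. -/
def d2Range : Submodule (Tgh k g h) (Tgh k g h × Tgh k g h × Tgh k g h) where
  carrier := Set.range (d2 k g h)
  zero_mem' := ⟨0, by simp [d2]⟩
  add_mem' := by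
    rintro _ _ ⟨u, rfl⟩ ⟨v, rfl⟩
    refine ⟨u + v, ?_⟩
    simp only [d2, Prod.fst_add, Prod.snd_add, Prod.mk_add_mk, Prod.mk.injEq, add_mul]
    refine ⟨?_, ?_, ?_⟩ <;> abel
  smul_mem' := by
    rintro c _ ⟨u, rfl⟩
    refine ⟨c • u, ?_⟩
    simp only [d2, Prod.smul_fst, Prod.smul_snd, Prod.smul_mk, smul_eq_mul, mul_add, mul_sub, mul_assoc]
    refine Prod.ext (congrArg (· - _) (mul_neg (α := Tgh k g h) _ _).symm) rfl

section Extension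

variable {M : Type*} [AddCommGroup M] [Module (Tgh k g h) M] [Module k M]
  [IsScalarTower k (Tgh k g h) M]

/-- The endomorphism `(m, c) ↦ (t • m + c • e, 0)` of `M × k`: it is the action of a generator
on an extension of the trivial module `k` by `M`. -/
def extAction (t : Tgh k g h) (e : M) : Module.End k (M × k) :=
  ((Algebra.lsmul k k M t).comp (LinearMap.fst k M k) +
    (LinearMap.toSpanSingleton k M e).comp (LinearMap.snd k M k)).prod 0

@[simp]
theorem extAction_apply (t : Tgh k g h) (e : M) (p : M × k) :
    extAction t e p = (t • p.1 + p.2 • e, 0) := rfl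

/-- Three elements of a `T`-module satisfying the relations given by `d2` define a derivation of
`T` which sends `u₁x + u₂y + u₃w` to `u₁e₁ + u₂e₂ + u₃e₃`. -/
theorem smul_add_smul_add_smul_eq_zero {e₁ e₂ e₃ : M}
    (hxy : Wx k g h • e₂ = Wy k g h • e₁)
    (hwy : Ww k g h • e₂ + Wy k g h • e₃ = Wx k g h • e₁ + g • Wy k g h • e₂)
    (hww : Ww k g h • e₃ = -(h • Wy k g h • e₂))
    {u : Tgh k g h × Tgh k g h × Tgh k g h} (hu : d1 k g h u = 0) :
    u.1 • e₁ + u.2.1 • e₂ + u.2.2 • e₃ = 0 := by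
  have act (t : Tgh k g h) {a b : Tgh k g h} (e e' : M) (hab : a * b = t) :
      extAction a e * extAction b e' =
        (Algebra.lsmul k k M t ∘ₗ LinearMap.fst k M k +
          LinearMap.toSpanSingleton k M (a • e') ∘ₗ LinearMap.snd k M k).prod 0 := by
    refine LinearMap.ext fun p => ?_
    simp [Module.End.mul_apply, ← hab, smul_comm a p.2 e']
  obtain ⟨f, fx, fy, fw⟩ := exists_lift (g := g) (h := h) (extAction (Wx k g h) e₁)
    (extAction (Wy k g h) e₂) (extAction (Ww k g h) e₃)
    (by rw [act _ _ _ x_mul_y, act _ _ _ rfl, hxy])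
    (by
      refine LinearMap.ext fun p => ?_
      have h1 := congrArg (· • p.1) (w_mul_y_add (k := k) (g := g) (h := h))
      have h2 := congrArg (p.2 • ·) hwy
      simp only [pow_two, add_smul, mul_smul, smul_assoc, smul_add] at h1 h2
      simp only [pow_two, Module.End.mul_apply, LinearMap.add_apply, LinearMap.smul_apply,
        extAction_apply, Prod.mk_add_mk, Prod.smul_mk, smul_zero, zero_smul, add_zero, smul_add,
        Prod.mk.injEq, and_true]
      simp only [smul_comm _ p.2] at h2 ⊢
      linear_combination (norm := abel) h1 + h2)
    (by
      refine LinearMap.ext fun p => ?_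
      have h1 := congrArg (· • p.1) (w_sq (k := k) (g := g) (h := h))
      have h2 := congrArg (p.2 • ·) hww
      simp only [pow_two, neg_smul (R := Tgh k g h), mul_smul, smul_assoc, smul_neg] at h1 h2
      simp only [pow_two, Module.End.mul_apply, LinearMap.neg_apply, LinearMap.smul_apply,
        extAction_apply, Prod.neg_mk, Prod.smul_mk, smul_zero, zero_smul, add_zero, smul_add,
        Prod.mk.injEq, and_true, neg_zero]
      simp only [smul_comm _ p.2] at h2 ⊢
      linear_combination (norm := abel) h1 + h2)
  have hf (t : Tgh k g h) (m : M) : f t (m, 0) = (t • m, 0) := by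
    induction t using Tgh.induction generalizing m with
    | scalar r => simp [AlgHom.commutes, Module.algebraMap_end_apply]
    | x => simp [fx]
    | y => simp [fy]
    | w => simp [fw]
    | mul a b ha hb => simp [ha, hb, mul_smul]
    | add a b ha hb => simp [ha, hb, add_smul]
  have key : f (d1 k g h u) (0, 1) = (u.1 • e₁ + u.2.1 • e₂ + u.2.2 • e₃, 0) := by
    simp [d1, fx, fy, fw, hf]
  simpa [hu] using (congrArg Prod.fst key).symm

end Extension

theorem exists_d2_of_d1_eq_zero {u : Tgh k g h × Tgh k g h × Tgh k g h}
    (hu : d1 k g h u = 0) : ∃ v, d2 k g h v = u := by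
  have hmk (v) : (d2Range k g h).mkQ (d2 k g h v) = 0 :=
    (Submodule.Quotient.mk_eq_zero _).2 ⟨v, rfl⟩
  have h1 := hmk (0, 0, 1)
  have h2 := hmk (1, 0, 0)
  have h3 := hmk (0, 1, 0)
  have key := smul_add_smul_add_smul_eq_zero
    (e₁ := (d2Range k g h).mkQ (1, 0, 0)) (e₂ := (d2Range k g h).mkQ (0, 1, 0))
    (e₃ := (d2Range k g h).mkQ (0, 0, 1))
    (by
      rw [← sub_eq_zero, ← map_smul, ← map_smul, ← map_sub, ← h1]
      simp [d2])
    (by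
      rw [← sub_eq_zero, ← smul_assoc, ← map_smul, ← map_smul, ← map_smul, ← map_smul,
        ← map_add, ← map_add, ← map_sub, ← h2]
      simp [d2])
    (by
      rw [← sub_eq_zero, sub_neg_eq_add, ← smul_assoc, ← map_smul, ← map_smul, ← map_add, ← h3]
      simp [d2])
    hu
  rw [← map_smul, ← map_smul, ← map_smul, ← map_add, ← map_add] at key
  exact (Submodule.Quotient.mk_eq_zero _).1 (by simpa using key)

/-! ### A faithful representation -/

section Representation

open MvPolynomial Matrix

theorem y_sq (hh : h ≠ 0) : Wy k g h ^ 2 = -(h⁻¹ • Ww k g h ^ 2) := by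
  rw [w_sq, smul_neg, neg_neg, inv_smul_smul₀ hh]

theorem commute_x_w_sq : Commute (Wx k g h) (Ww k g h ^ 2) := by
  rw [w_sq]
  have : Commute (Wx k g h) (Wy k g h) := x_mul_y
  exact Commute.neg_right ((this.pow_right 2).smul_right h)

theorem commute_w_y_sq (hh : h ≠ 0) : Commute (Ww k g h) (Wy k g h ^ 2) := by
  rw [y_sq hh]
  exact Commute.neg_right (((Commute.refl (Ww k g h)).pow_right 2).smul_right h⁻¹)

theorem commute_y_w_sq : Commute (Wy k g h) (Ww k g h ^ 2) := by
  rw [w_sq]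
  exact Commute.neg_right (((Commute.refl (Wy k g h)).pow_right 2).smul_right h)

theorem commute_w_x_sq (hh : h ≠ 0) : Commute (Ww k g h) (Wx k g h ^ 2) := by
  have h1 : Commute (Ww k g h) (g • Wy k g h ^ 2) := (commute_w_y_sq hh).smul_right g
  have h2 : Wy k g h * Ww k g h ^ 2 = Ww k g h ^ 2 * Wy k g h := commute_y_w_sq
  rw [← add_sub_cancel_right (Wx k g h ^ 2) (g • Wy k g h ^ 2), ← w_mul_y_add]
  refine Commute.sub_right ?_ h1
  rw [commute_iff_eq]
  linear_combination (norm := noncomm_ring) -h2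

open scoped IsMulCommutative in
theorem _root_.MvPolynomial.exists_aeval_of_commute {R σ B : Type*} [CommRing R] [Ring B]
    [Algebra R B] (a : σ → B) (ha : ∀ i j, Commute (a i) (a j)) :
    ∃ α : MvPolynomial σ R →ₐ[R] B, ∀ i, α (X i) = a i := by
  have hcomm : ∀ b ∈ Set.range a, ∀ c ∈ Set.range a, b * c = c * b := by
    rintro _ ⟨i, rfl⟩ _ ⟨j, rfl⟩
    exact ha i j
  have := Algebra.isMulCommutative_adjoin R hcomm
  let a' (i : σ) : Algebra.adjoin R (Set.range a) := ⟨a i, Algebra.subset_adjoin ⟨i, rfl⟩⟩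
  exact ⟨(Algebra.adjoin R (Set.range a)).val.comp (aeval a'), fun i => by simp [a']⟩

theorem exists_aeval (hh : h ≠ 0) : ∃ α : MvPolynomial (Fin 3) k →ₐ[k] Tgh k g h,
    α (X 0) = Wx k g h ∧ α (X 1) = Ww k g h ^ 2 ∧
    α (X 2) = Wx k g h * Ww k g h + Ww k g h * Wx k g h := by
  let a : Fin 3 → Tgh k g h :=
    ![Wx k g h, Ww k g h ^ 2, Wx k g h * Ww k g h + Ww k g h * Wx k g h]
  have h01 : Commute (a 0) (a 1) := commute_x_w_sq
  have h02 : Commute (a 0) (a 2) := by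
    have := (commute_w_x_sq (k := k) (g := g) hh).eq
    simp only [a, commute_iff_eq, cons_val]
    linear_combination (norm := noncomm_ring) -this
  have h12 : Commute (a 1) (a 2) := by
    have hw : Commute (Ww k g h ^ 2) (Ww k g h) := (Commute.refl _).pow_left 2
    exact (h01.symm.mul_right hw).add_right (hw.mul_right h01.symm)
  obtain ⟨α, hα⟩ := exists_aeval_of_commute (R := k) a fun i j => by
    fin_cases i <;> fin_cases j <;>
      first
        | exact Commute.refl _
        | exact h01
        | exact h02
        | exact h12
        | exact h01.symm
        | exact h02.symm
        | exact h12.symm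
  exact ⟨α, hα 0, hα 1, hα 2⟩

variable (k) in
/-- Right multiplication by `x` in the basis `1, w, y, wy` of `T` over `k[x, w², xw + wx]`. -/
def matX : Matrix (Fin 4) (Fin 4) (MvPolynomial (Fin 3) k) :=
  !![X 0, 0, 0, 0; X 2, -X 0, 0, 0; 0, 0, X 0, 0; 0, 0, X 2, -X 0]

/-- Right multiplication by `y` in the basis `1, w, y, wy` of `T` over `k[x, w², xw + wx]`. -/
def matY (h : k) : Matrix (Fin 4) (Fin 4) (MvPolynomial (Fin 3) k) :=
  !![0, 0, 1, 0; 0, 0, 0, 1; -(C h⁻¹ * X 1), 0, 0, 0; 0, -(C h⁻¹ * X 1), 0, 0]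

/-- Right multiplication by `w` in the basis `1, w, y, wy` of `T` over `k[x, w², xw + wx]`. -/
def matW (g h : k) : Matrix (Fin 4) (Fin 4) (MvPolynomial (Fin 3) k) :=
  !![0, 1, 0, 0; X 1, 0, 0, 0; X 0 ^ 2 - C (g * h⁻¹) * X 1, 0, 0, -1;
    0, X 0 ^ 2 - C (g * h⁻¹) * X 1, -X 1, 0]

theorem vecMul_matX (v : Fin 4 → MvPolynomial (Fin 3) k) :
    v ᵥ* matX k = ![v 0 * X 0 + v 1 * X 2, -(v 1 * X 0), v 2 * X 0 + v 3 * X 2, -(v 3 * X 0)] := by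
  funext i
  fin_cases i <;> simp [matX, vecMul, dotProduct, Fin.sum_univ_four]

theorem vecMul_matY (v : Fin 4 → MvPolynomial (Fin 3) k) :
    v ᵥ* matY h = ![-(v 2 * (C h⁻¹ * X 1)), -(v 3 * (C h⁻¹ * X 1)), v 0, v 1] := by
  funext i
  fin_cases i <;> simp [matY, vecMul, dotProduct, Fin.sum_univ_four]

theorem vecMul_matW (v : Fin 4 → MvPolynomial (Fin 3) k) :
    v ᵥ* matW g h = ![v 1 * X 1 + v 2 * (X 0 ^ 2 - C (g * h⁻¹) * X 1),
      v 0 + v 3 * (X 0 ^ 2 - C (g * h⁻¹) * X 1), -(v 3 * X 1), -v 2] := by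
  funext i
  fin_cases i <;> simp [matW, vecMul, dotProduct, Fin.sum_univ_four]

theorem matX_mul_matY : matX k * matY h = matY h * matX k := by
  ext1 i j
  fin_cases i <;> fin_cases j <;> simp [matX, matY, mul_apply, Fin.sum_univ_four, mul_comm]

theorem matY_sq : matY h ^ 2 = diagonal fun _ => -(C h⁻¹ * X 1) := by
  ext1 i j
  fin_cases i <;> fin_cases j <;> simp [matY, pow_two, mul_apply, Fin.sum_univ_four]

theorem matX_sq : matX k ^ 2 = diagonal fun _ => X 0 ^ 2 := by
  ext1 i j
  fin_cases i <;> fin_cases j <;>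
    simp [matX, pow_two, mul_apply, Fin.sum_univ_four, mul_comm]

theorem matW_sq : matW g h ^ 2 = diagonal fun _ => X 1 := by
  ext1 i j
  fin_cases i <;> fin_cases j <;>
    simp [matW, pow_two, mul_apply, Fin.sum_univ_four, mul_comm]

theorem matW_mul_matY_add : matW g h * matY h + matY h * matW g h =
    diagonal fun _ => X 0 ^ 2 - C (g * h⁻¹) * X 1 := by
  ext1 i j
  fin_cases i <;> fin_cases j <;>
    simp [matW, matY, mul_comm]

theorem exists_representation (hh : h ≠ 0) :
    ∃ ρ : Tgh k g h →ₐ[k] Matrix (Fin 4) (Fin 4) (MvPolynomial (Fin 3) k),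
      ρ (Wx k g h) = matX k ∧ ρ (Wy k g h) = matY h ∧ ρ (Ww k g h) = matW g h := by
  refine exists_lift _ _ _ matX_mul_matY ?_ ?_
  · rw [matW_mul_matY_add, matX_sq, matY_sq, ← diagonal_smul, diagonal_add]
    congr 1
    funext i
    simp [smul_eq_C_mul, mul_assoc, sub_eq_add_neg]
  · rw [matW_sq, matY_sq, ← diagonal_smul, diagonal_neg]
    congr 1
    funext i
    simp [smul_eq_C_mul, ← mul_assoc, ← C_mul, hh]

/-- The element `v₀ + v₁w + v₂y + v₃wy` of `T`. -/
def ofCoords (α : MvPolynomial (Fin 3) k →ₐ[k] Tgh k g h)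
    (v : Fin 4 → MvPolynomial (Fin 3) k) : Tgh k g h :=
  α (v 0) + α (v 1) * Ww k g h + α (v 2) * Wy k g h + α (v 3) * (Ww k g h * Wy k g h)

section OfCoords

variable {α : MvPolynomial (Fin 3) k →ₐ[k] Tgh k g h}

theorem ofCoords_add (u v : Fin 4 → MvPolynomial (Fin 3) k) :
    ofCoords α (u + v) = ofCoords α u + ofCoords α v := by
  simp only [ofCoords, Pi.add_apply, map_add, add_mul]
  abel

theorem ofCoords_smul (c : k) (v : Fin 4 → MvPolynomial (Fin 3) k) :
    ofCoords α (c • v) = c • ofCoords α v := by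
  simp only [ofCoords, Pi.smul_apply, map_smul, smul_mul_assoc, smul_add]

theorem ofCoords_vecMul_matX (hα₀ : α (X 0) = Wx k g h)
    (hα₂ : α (X 2) = Wx k g h * Ww k g h + Ww k g h * Wx k g h)
    (v : Fin 4 → MvPolynomial (Fin 3) k) :
    ofCoords α (v ᵥ* matX k) = ofCoords α v * Wx k g h := by
  have h1 := congrArg (α (v 2) * ·) (x_mul_y (k := k) (g := g) (h := h))
  have h2 := congrArg (α (v 3) * Ww k g h * ·) (x_mul_y (k := k) (g := g) (h := h))
  simp only [ofCoords, vecMul_matX, cons_val, map_add, map_neg, map_mul, hα₀, hα₂, add_mul,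
    mul_add, neg_mul (α := Tgh k g h), mul_assoc] at *
  linear_combination (norm := module) h1 + h2

theorem ofCoords_vecMul_matY (hα₁ : α (X 1) = Ww k g h ^ 2) (hh : h ≠ 0)
    (v : Fin 4 → MvPolynomial (Fin 3) k) :
    ofCoords α (v ᵥ* matY h) = ofCoords α v * Wy k g h := by
  have h1 := congrArg (α (v 2) * ·) (y_sq (k := k) (g := g) hh)
  have h2 := congrArg (α (v 3) * Ww k g h * ·) (y_sq (k := k) (g := g) hh)
  have hC : α (C h⁻¹) = h⁻¹ • 1 := by
    rw [← algebraMap_eq, AlgHom.commutes, Algebra.algebraMap_eq_smul_one]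
  simp only [ofCoords, vecMul_matY, cons_val, map_neg, map_mul, hα₁, hC, add_mul, pow_two,
    mul_neg (α := Tgh k g h), neg_mul (α := Tgh k g h), mul_assoc, smul_mul_assoc, mul_smul_comm,
    one_mul] at *
  linear_combination (norm := module) -h1 - h2

theorem ofCoords_vecMul_matW (hα₀ : α (X 0) = Wx k g h)
    (hα₁ : α (X 1) = Ww k g h ^ 2) (hh : h ≠ 0) (v : Fin 4 → MvPolynomial (Fin 3) k) :
    ofCoords α (v ᵥ* matW g h) = ofCoords α v * Ww k g h := by
  have hC (c : k) : α (C c) = c • 1 := by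
    rw [← algebraMap_eq, AlgHom.commutes, Algebra.algebraMap_eq_smul_one]
  have hwy : Wy k g h * Ww k g h =
      Wx k g h ^ 2 - (g * h⁻¹) • Ww k g h ^ 2 - Ww k g h * Wy k g h := by
    rw [mul_smul, eq_sub_iff_add_eq, add_comm, w_mul_y_add, y_sq hh, smul_neg (A := Tgh k g h),
      sub_eq_add_neg]
  have h1 := congrArg (α (v 2) * ·) hwy
  have h2 := congrArg (α (v 3) * Ww k g h * ·) hwy
  have h3 := congrArg (α (v 3) * ·) (commute_w_x_sq (k := k) (g := g) hh).eq
  simp only [ofCoords, vecMul_matW, cons_val, map_add, map_neg, map_sub, map_mul, hα₀,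
    hα₁, hC, add_mul, mul_sub, sub_mul, pow_two, neg_mul (α := Tgh k g h), mul_assoc, smul_mul_assoc, mul_smul_comm, one_mul] at *
  linear_combination (norm := module) -h1 - h2 - h3

end OfCoords

theorem exists_coords (hh : h ≠ 0) :
    ∃ (coords : Tgh k g h →ₗ[k] Fin 4 → MvPolynomial (Fin 3) k)
      (elt : (Fin 4 → MvPolynomial (Fin 3) k) → Tgh k g h),
      (∀ t, elt (coords t) = t) ∧ (∀ v, elt (v ᵥ* matX k) = elt v * Wx k g h) ∧
      (∀ t, coords (t * Wx k g h) = coords t ᵥ* matX k) ∧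
      (∀ t, coords (t * Wy k g h) = coords t ᵥ* matY h) ∧
      (∀ t, coords (t * Ww k g h) = coords t ᵥ* matW g h) := by
  obtain ⟨α, h₀, h₁, h₂⟩ := exists_aeval (k := k) (g := g) hh
  obtain ⟨ρ, hx, hy, hw⟩ := exists_representation (k := k) (g := g) hh
  have key (t : Tgh k g h) (v) : ofCoords α (v ᵥ* ρ t) = ofCoords α v * t := by
    induction t using Tgh.induction generalizing v with
    | scalar r =>
      rw [Algebra.algebraMap_eq_smul_one, map_smul, map_one, vecMul_smul, vecMul_one,
        ofCoords_smul, mul_smul_comm, mul_one]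
    | x => rw [hx, ofCoords_vecMul_matX h₀ h₂]
    | y => rw [hy, ofCoords_vecMul_matY h₁ hh]
    | w => rw [hw, ofCoords_vecMul_matW h₀ h₁ hh]
    | mul a b ha hb => rw [map_mul, ← vecMul_vecMul, hb, ha, mul_assoc]
    | add a b ha hb => rw [map_add, vecMul_add, ofCoords_add, ha, hb, mul_add]
  let coords : Tgh k g h →ₗ[k] Fin 4 → MvPolynomial (Fin 3) k :=
    { toFun t := Pi.single 0 1 ᵥ* ρ t
      map_add' a b := by rw [map_add, vecMul_add]
      map_smul' c a := by rw [map_smul, vecMul_smul, RingHom.id_apply] }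
  have hmul (t u : Tgh k g h) : coords (t * u) = coords t ᵥ* ρ u := by
    simp only [coords, LinearMap.coe_mk, AddHom.coe_mk, map_mul, vecMul_vecMul]
  refine ⟨coords, ofCoords α, fun t => ?_, ofCoords_vecMul_matX h₀ h₂, fun t => ?_, fun t => ?_,
    fun t => ?_⟩
  · exact (key t _).trans (by simp [ofCoords])
  · rw [hmul, hx]
  · rw [hmul, hy]
  · rw [hmul, hw]

theorem eq_zero_of_mul_x_eq_zero (hh : h ≠ 0) {t : Tgh k g h} (ht : t * Wx k g h = 0) :
    t = 0 := by
  obtain ⟨coords, elt, hinv, -, hx, -, -⟩ := exists_coords (k := k) (g := g) hh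
  suffices coords t = 0 by rw [← hinv t, this, ← map_zero coords, hinv]
  have := hx t
  rw [ht, map_zero, eq_comm, funext_iff] at this
  simp [vecMul_matX, Fin.forall_fin_succ] at this
  obtain ⟨e0, e1, e2, e3⟩ := this
  funext i
  fin_cases i <;> simp_all

theorem eq_zero_of_mul_w_eq_zero (hh : h ≠ 0) {t : Tgh k g h} (ht : t * Ww k g h = 0) :
    t = 0 := by
  obtain ⟨coords, elt, hinv, -, -, -, hw⟩ := exists_coords (k := k) (g := g) hh
  suffices coords t = 0 by rw [← hinv t, this, ← map_zero coords, hinv]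
  have := hw t
  rw [ht, map_zero, eq_comm, funext_iff] at this
  simp [vecMul_matW, Fin.forall_fin_succ] at this
  obtain ⟨e0, e1, e2, e3⟩ := this
  funext i
  fin_cases i <;> simp_all

theorem _root_.MvPolynomial.X_dvd_of_X_dvd_mul_X {R σ : Type*} [CommRing R] [IsDomain R]
    {i j : σ} (hij : i ≠ j) {p : MvPolynomial σ R}
    (hp : (X i : MvPolynomial σ R) ∣ p * X j) : X i ∣ p :=
  (X_prime.dvd_or_dvd hp).resolve_right fun hd => hij (X_dvd_X.1 hd)

theorem exists_mul_x_eq (hh : h ≠ 0) {a b : Tgh k g h}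
    (hab : a * Wx k g h + b * Wy k g h = 0) : ∃ c, c * Wx k g h = b := by
  obtain ⟨coords, elt, hinv, hex, hx, hy, -⟩ := exists_coords (k := k) (g := g) hh
  have hC : (C h * C h⁻¹ : MvPolynomial (Fin 3) k) = 1 := by
    rw [← C_mul, mul_inv_cancel₀ hh, C_1]
  have := congrArg coords hab
  rw [map_add, hx, hy, map_zero, funext_iff] at this
  simp [vecMul_matX, vecMul_matY, Fin.forall_fin_succ] at this
  obtain ⟨e0, e1, e2, e3⟩ := this
  obtain ⟨m, hm⟩ : (X 1 : MvPolynomial (Fin 3) k) ∣ coords a 1 :=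
    X_dvd_of_X_dvd_mul_X (j := 0) (by decide)
      ⟨-(coords b 3 * C h⁻¹), by linear_combination -e1⟩
  rw [hm] at e0 e1
  obtain ⟨n, hn⟩ : (X 1 : MvPolynomial (Fin 3) k) ∣ coords a 0 :=
    X_dvd_of_X_dvd_mul_X (j := 0) (by decide)
      ⟨coords b 2 * C h⁻¹ - m * X 2, by linear_combination e0⟩
  rw [hn] at e0
  have hW : (X 1 : MvPolynomial (Fin 3) k) ≠ 0 := X_ne_zero 1
  refine ⟨elt ![-coords a 2, -coords a 3, C h * n, C h * m], ?_⟩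
  rw [← hex, ← hinv b]
  congr 1
  funext i
  fin_cases i <;> simp [vecMul_matX]
  · linear_combination -e2
  · linear_combination -e3
  · apply mul_left_cancel₀ hW
    linear_combination C h * e0 + X 1 * coords b 2 * hC
  · apply mul_left_cancel₀ hW
    linear_combination C h * e1 + X 1 * coords b 3 * hC

end Representation

theorem exists_d3_of_d2_eq_zero (hh : h ≠ 0) {u : Tgh k g h × Tgh k g h × Tgh k g h}
    (hu : d2 k g h u = 0) : ∃ t, d3 k g h t = u := by
  obtain ⟨a, b, c⟩ := u
  simp only [d2, Prod.mk_eq_zero] at hu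
  obtain ⟨h1, -, h3⟩ := hu
  have h1' : a * Wx k g h + c * Wy k g h = 0 := by
    rw [← neg_eq_zero (α := Tgh k g h), neg_add', h1]
  obtain ⟨t, rfl⟩ := exists_mul_x_eq hh h1'
  have ha : a = -(t * Wy k g h) := by
    refine eq_neg_of_add_eq_zero_left (eq_zero_of_mul_x_eq_zero hh ?_)
    rw [add_mul, mul_assoc, ← x_mul_y, ← mul_assoc, h1']
  subst ha
  have hb : b + h⁻¹ • (t * Ww k g h) = 0 := by
    refine eq_zero_of_mul_w_eq_zero hh ?_
    rw [← h3, add_mul, smul_mul_assoc, mul_assoc, neg_mul (α := Tgh k g h), mul_assoc, ← pow_two,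
      ← pow_two, y_sq hh, mul_neg (α := Tgh k g h), neg_neg, mul_smul_comm, add_comm]
  refine ⟨-(h⁻¹ • t), Prod.ext ?_ (Prod.ext ?_ ?_)⟩
  · simp only [d3, neg_mul (α := Tgh k g h), smul_mul_smul_comm, inv_mul_cancel₀ hh, one_smul]
  · simp only [d3, neg_mul (α := Tgh k g h), smul_mul_assoc]
    exact (eq_neg_of_add_eq_zero_left hb).symm
  · simp only [d3, neg_mul (α := Tgh k g h), smul_mul_smul_comm, inv_mul_cancel₀ hh, one_smul,
      neg_neg]

end Tgh

/-- If `h ≠ 0`, the sequence `0 → T → T³ → T³ → T → k → 0` given by `d₃`, `d₂`, `d₁` and the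
augmentation `ε` (the unique `k`-algebra homomorphism killing `x`, `y`, `w`) is exact; i.e.
it is a free resolution of the trivial left `T(g,h)`-module `k`, so `T(g,h)` is Koszul. -/
theorem stmt19 {k : Type*} [Field k] [IsAlgClosed k] (hchar : ringChar k ≠ 2)
    (g h : k) (hh : h ≠ 0)
    (ε : Tgh k g h →ₐ[k] k) (hεx : ε (Wx k g h) = 0) (hεy : ε (Wy k g h) = 0)
    (hεw : ε (Ww k g h) = 0) :
    Function.Injective (d3 k g h) ∧
    (∀ u, d2 k g h u = 0 ↔ ∃ t, d3 k g h t = u) ∧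
    (∀ u, d1 k g h u = 0 ↔ ∃ v, d2 k g h v = u) ∧
    (∀ t, ε t = 0 ↔ ∃ u, d1 k g h u = t) ∧
    Function.Surjective ε := by
  refine ⟨fun s t hst => ?_, fun u => ⟨fun hu => ?_, ?_⟩, fun u => ⟨?_, ?_⟩, fun t => ⟨?_, ?_⟩,
    fun c => ⟨algebraMap k _ c, by simp⟩⟩
  · have : s * Ww k g h = t * Ww k g h := congrArg (fun p => p.2.1) hst
    exact sub_eq_zero.1 (Tgh.eq_zero_of_mul_w_eq_zero hh (by rw [sub_mul, this, sub_self]))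
  · exact Tgh.exists_d3_of_d2_eq_zero hh hu
  · rintro ⟨t, rfl⟩
    exact Tgh.d2_d3 t
  · exact Tgh.exists_d2_of_d1_eq_zero
  · rintro ⟨v, rfl⟩
    exact Tgh.d1_d2 v
  · intro ht
    obtain ⟨u, hu⟩ := Tgh.exists_d1_add_algebraMap ε hεx hεy hεw t
    exact ⟨u, by simpa [ht] using hu⟩
  · rintro ⟨u, rfl⟩
    simp [d1, hεx, hεy, hεw]
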